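/- Let H be a complex Hilbert space, let K : H → H be a bounded self-adjoint linear operator, and let k₀ > 0 be a real number. Assume that K³ − k₀²K is a compact operator but K(K − k₀I) is not compact. Then there exists an orthonormal sequence (xₙ) in H such that ‖K xₙ + k₀ xₙ‖ → 0 as n → ∞. -/

import Mathlib

open Filter
open scoped Topology

theorem IsCompactOperator.of_isClosedEmbedding_comp {X Y Z : Type*} [Zero X]
    [TopologicalSpace X] [TopologicalSpace Y] [TopologicalSpace Z] {f : X → Y} {g : Y → Z}
    (hg : Topology.IsClosedEmbedding g) (hgf : IsCompactOperator (g ∘ f)) : IsCompactOperator f := by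
  obtain ⟨C, hC, hmem⟩ := hgf
  exact ⟨g ⁻¹' C, hg.isCompact_preimage hC, hmem⟩

/-- If `S ∘ T` is compact but `T` is not, then `S` is not bounded below on the orthogonal complement
of any finite-dimensional subspace. -/
theorem exists_mem_orthogonal_norm_map_lt {𝕜 E F G : Type*} [RCLike 𝕜] [NormedAddCommGroup E]
    [NormedSpace 𝕜 E] [NormedAddCommGroup F] [InnerProductSpace 𝕜 F] [CompleteSpace F]
    [NormedAddCommGroup G] [NormedSpace 𝕜 G] {S : F →L[𝕜] G} {T : E →L[𝕜] F}
    (hST : IsCompactOperator (S ∘L T)) (hT : ¬ IsCompactOperator T)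
    (V : Submodule 𝕜 F) [FiniteDimensional 𝕜 V] {ε : ℝ} (hε : 0 < ε) :
    ∃ x ∈ Vᗮ, ‖x‖ = 1 ∧ ‖S x‖ < ε := by
  by_contra! h
  have hbound : ∀ x : Vᗮ, ‖x‖ ≤ (Real.toNNReal ε⁻¹ : ℝ) * ‖(S ∘L Vᗮ.subtypeL) x‖ := by
    intro x
    rw [Real.coe_toNNReal _ (inv_nonneg.2 hε.le)]
    rcases eq_or_ne x 0 with rfl | hx
    · simp
    have hx' : ‖(x : F)‖ ≠ 0 := by simpa using hx
    have hle := h (((‖(x : F)‖⁻¹ : ℝ) : 𝕜) • (x : F)) (Vᗮ.smul_mem _ x.2)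
      (by simp [norm_smul, hx'])
    rw [map_smul, norm_smul, RCLike.norm_ofReal, abs_inv, abs_norm, inv_mul_eq_div,
      le_div_iff₀ (by positivity)] at hle
    rw [inv_mul_eq_div, le_div_iff₀' hε]
    simpa using hle
  have hemb : Topology.IsClosedEmbedding (S ∘L Vᗮ.subtypeL) :=
    ((S ∘L Vᗮ.subtypeL).antilipschitz_of_bound hbound).isClosedEmbedding
      (S ∘L Vᗮ.subtypeL).uniformContinuous
  have hfin : IsCompactOperator (V.subtypeL ∘L V.orthogonalProjectionOnto ∘L T) := by
    have : ProperSpace V := FiniteDimensional.proper_rclike 𝕜 V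
    exact (isCompactOperator_of_locallyCompactSpace_dom
      (V.orthogonalProjectionOnto ∘L T)).clm_comp V.subtypeL
  have hdecomp : ∀ x, (V.orthogonalProjectionOnto (T x) : F) + Vᗮ.orthogonalProjectionOnto (T x) = T x :=
    fun x => V.starProjection_add_starProjection_orthogonal (T x)
  have hcomp : IsCompactOperator (Vᗮ.orthogonalProjectionOnto ∘L T) := by
    refine .of_isClosedEmbedding_comp hemb ?_
    refine (congrArg IsCompactOperator (funext fun x => ?_)).mp (hST.sub (hfin.clm_comp S))
    simp
  exact hT ((congrArg IsCompactOperator (funext hdecomp)).mp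
    (hfin.add (hcomp.clm_comp Vᗮ.subtypeL)))

theorem exists_orthonormal_tendsto_norm_map_zero {𝕜 E F G : Type*} [RCLike 𝕜]
    [NormedAddCommGroup E] [NormedSpace 𝕜 E] [NormedAddCommGroup F] [InnerProductSpace 𝕜 F]
    [CompleteSpace F] [NormedAddCommGroup G] [NormedSpace 𝕜 G] {S : F →L[𝕜] G} {T : E →L[𝕜] F}
    (hST : IsCompactOperator (S ∘L T)) (hT : ¬ IsCompactOperator T) :
    ∃ x : ℕ → F, Orthonormal 𝕜 x ∧ Tendsto (fun n => ‖S (x n)‖) atTop (𝓝 0) := by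
  classical
  obtain ⟨f, hf, hr⟩ := exists_seq_of_forall_finset_exists
    (fun p : F × ℕ => ‖p.1‖ = 1 ∧ ‖S p.1‖ < 1 / ((p.2 : ℝ) + 1))
    (fun p q => inner 𝕜 p.1 q.1 = 0 ∧ p.2 < q.2) (fun s _ => by
      obtain ⟨x, hxV, hx, hSx⟩ := exists_mem_orthogonal_norm_map_lt hST hT
        (Submodule.span 𝕜 (s.image Prod.fst : Set F))
        (Nat.one_div_pos_of_nat (α := ℝ) (n := s.sup Prod.snd + 1))
      refine ⟨(x, s.sup Prod.snd + 1), ⟨hx, hSx⟩, fun p hp => ⟨?_, ?_⟩⟩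
      · exact hxV _ (Submodule.subset_span (Finset.mem_coe.2 (Finset.mem_image_of_mem _ hp)))
      · exact Nat.lt_succ_of_le (Finset.le_sup (f := Prod.snd) hp))
  have hmono : StrictMono fun n => (f n).2 := fun m n hmn => (hr m n hmn).2
  refine ⟨fun n => (f n).1, ⟨fun n => (hf n).1, fun m n hmn => ?_⟩, ?_⟩
  · rcases hmn.lt_or_gt with h | h
    · exact (hr m n h).1
    · exact inner_eq_zero_symm.1 (hr n m h).1
  · exact squeeze_zero (fun _ => norm_nonneg _) (fun n => (hf n).2.le)
      (tendsto_one_div_add_atTop_nhds_zero_nat.comp hmono.tendsto_atTop)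

/-- if `K` is self-adjoint, `K³ - k₀²K` is compact but `K(K - k₀I)`
is not, then `-k₀` lies in the essential spectrum of `K`: there is an orthonormal
(singular Weyl) sequence `(xₙ)` with `‖K xₙ + k₀ xₙ‖ → 0`. -/
theorem statement14 {H : Type*} [NormedAddCommGroup H] [InnerProductSpace ℂ H]
    [CompleteSpace H]
    (K : H →L[ℂ] H) (hK : IsSelfAdjoint K) (k₀ : ℝ) (hk₀ : 0 < k₀)
    (hcpt : IsCompactOperator (⇑(K ∘L K ∘L K - ((k₀ : ℂ)^2) • K)))
    (hncpt : ¬ IsCompactOperator (⇑(K ∘L (K - (k₀ : ℂ) • (1 : H →L[ℂ] H))))) :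
    ∃ x : ℕ → H, Orthonormal ℂ x ∧
      Tendsto (fun n => ‖K (x n) + (k₀ : ℂ) • x n‖) atTop (𝓝 0) := by
  have hfactor : K ∘L K ∘L K - ((k₀ : ℂ) ^ 2) • K =
      (K + (k₀ : ℂ) • (1 : H →L[ℂ] H)) ∘L (K ∘L (K - (k₀ : ℂ) • (1 : H →L[ℂ] H))) := by
    ext x
    simp only [ContinuousLinearMap.comp_apply, add_apply,
      sub_apply, smul_apply,
      one_apply_eq_self, map_sub, map_smul]
    module
  rw [hfactor] at hcpt
  exact exists_orthonormal_tendsto_norm_map_zero hcpt hncpt
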